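/- Let φ be a flow on a generalized Peano continuum M. Then HS, with the Hausdorff metric, is locally a Peano continuum (every Λ ∈ HS has arbitrarily small neighborhoods in HS that are compact, connected and locally connected), and HS is the union of countably many pairwise disjoint connected components, each of which is open and closed in HS and, as a metric space, is a generalized Peano continuum (locally compact, connected, locally connected). -/

import Mathlib

open Set Filter Topology Metric TopologicalSpace

variable {M : Type*} [MetricSpace M]

/-- A set is invariant under the flow `φ`. -/
def IsFlowInvariant (φ : ℝ → M → M) (K : Set M) : Prop :=
  ∀ x ∈ K, ∀ t : ℝ, φ t x ∈ K

/-- A set is positively invariant under the flow `φ`. -/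
def IsPosInvariant (φ : ℝ → M → M) (K : Set M) : Prop :=
  ∀ x ∈ K, ∀ t : ℝ, 0 ≤ t → φ t x ∈ K

/-- A compact minimal set: nonempty, compact, invariant, with no nonempty proper
closed invariant subset. -/
def IsCompactMinimalSet (φ : ℝ → M → M) (K : Set M) : Prop :=
  K.Nonempty ∧ IsCompact K ∧ IsFlowInvariant φ K ∧
    ∀ K' ⊆ K, K'.Nonempty → IsClosed K' → IsFlowInvariant φ K' → K' = K

/-- Lyapunov stability: every neighborhood of `K` contains a positively invariant
neighborhood of `K`. -/
def IsLyapunovStable (φ : ℝ → M → M) (K : Set M) : Prop :=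
  ∀ U ∈ 𝓝ˢ K, ∃ V ∈ 𝓝ˢ K, V ⊆ U ∧ IsPosInvariant φ V

/-- The ω-limit set of a point. -/
def omegaLimitSet (φ : ℝ → M → M) (x : M) : Set M :=
  ⋂ T ∈ Ici (0 : ℝ), closure ((fun t => φ t x) '' Ici T)

/-- The α-limit set of a point. -/
def alphaLimitSet (φ : ℝ → M → M) (x : M) : Set M :=
  ⋂ T ∈ Iic (0 : ℝ), closure ((fun t => φ t x) '' Iic T)

/-- A compact minimal set is hyper-stable if some neighborhood of it in `M` meets no
Lyapunov unstable compact minimal set. -/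
def IsHyperStable (φ : ℝ → M → M) (Λ : Set M) : Prop :=
  IsCompactMinimalSet φ Λ ∧ ∃ W ∈ 𝓝ˢ Λ, ∀ Γ : Set M,
    IsCompactMinimalSet φ Γ → ¬ IsLyapunovStable φ Γ → Γ ∩ W = ∅

/-- An attractor: a Lyapunov stable nonempty compact invariant set whose basin of
attraction is a neighborhood of it. -/
def IsAttractorSet (φ : ℝ → M → M) (Δ : Set M) : Prop :=
  Δ.Nonempty ∧ IsCompact Δ ∧ IsFlowInvariant φ Δ ∧ IsLyapunovStable φ Δ ∧
    {x : M | (omegaLimitSet φ x).Nonempty ∧ omegaLimitSet φ x ⊆ Δ} ∈ 𝓝ˢ Δ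

/-- The flow is non-wandering. -/
def IsNonWanderingFlow (φ : ℝ → M → M) : Prop :=
  ∀ x : M, ∀ U ∈ 𝓝 x, ∀ T > (0 : ℝ), ∃ t ≥ T, ((fun y => φ t y) '' U ∩ U).Nonempty

/-- The set of hyper-stable compact minimal sets, as a subset of the space of nonempty
compact subsets of `M` (with the Hausdorff metric). -/
def HSset (φ : ℝ → M → M) : Set (NonemptyCompacts M) :=
  {Γ | IsHyperStable φ (Γ : Set M)}

/-- The set of all compact minimal sets, as a subset of the space of nonempty compact
subsets of `M` (with the Hausdorff metric). -/
def CMinSet (φ : ℝ → M → M) : Set (NonemptyCompacts M) :=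
  {Γ | IsCompactMinimalSet φ (Γ : Set M)}

/-- `basinOf φ X` is the set of points whose ω-limit set belongs to `X`. -/
def basinOf (φ : ℝ → M → M) (X : Set (NonemptyCompacts M)) : Set M :=
  {x | ∃ Γ ∈ X, (Γ : Set M) = omegaLimitSet φ x}

/-- The union in `M` of a family of hyper-stable compact minimal sets. -/
def unionSet (φ : ℝ → M → M) (X : Set ↥(HSset φ)) : Set M :=
  {y | ∃ q ∈ X, y ∈ ((q : NonemptyCompacts M) : Set M)}

/-- The union of `A` with all members of `F` that meet it. -/
def enlarge {X : Type*} (F : Set (Set X)) (A : Set X) : Set X :=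
  A ∪ ⋃₀ {B ∈ F | (B ∩ A).Nonempty}

/-- Enlarge `A` successively along the first `m` families of the sequence `F`. -/
def iterEnlarge {X : Type*} (F : ℕ → Set (Set X)) (A : Set X) : ℕ → Set X
  | 0 => A
  | m + 1 => enlarge (F m) (iterEnlarge F A m)

/-- Enlarge `A` successively along all families of the sequence `F`. -/
def limEnlarge {X : Type*} (F : ℕ → Set (Set X)) (A : Set X) : Set X :=
  ⋃ m, iterEnlarge F A m

lemma subset_enlarge {X : Type*} (F : Set (Set X)) (A : Set X) : A ⊆ enlarge F A :=
  subset_union_left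

lemma enlarge_iUnion {X ι : Type*} (F : Set (Set X)) (A : ι → Set X) :
    enlarge F (⋃ i, A i) = ⋃ i, enlarge F (A i) := by
  ext x
  simp only [enlarge, Set.Nonempty, mem_union, mem_iUnion, mem_sUnion, mem_ofPred_eq, mem_inter_iff]
  grind

lemma enlarge_eq_biUnion {X : Type*} {F : Set (Set X)} {A : Set X} (h : A ⊆ ⋃₀ F) :
    enlarge F A = ⋃ B : {B // B ∈ F ∧ (B ∩ A).Nonempty}, (B : Set X) := by
  ext x
  simp only [enlarge, mem_union, mem_iUnion, mem_sUnion, mem_ofPred_eq, Subtype.exists, exists_prop]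
  refine ⟨?_, fun h => .inr h⟩
  rintro (hx | hx)
  · obtain ⟨B, hB, hxB⟩ := h hx
    exact ⟨B, ⟨hB, x, hxB, hx⟩, hxB⟩
  · exact hx

lemma IsConnected.enlarge {X : Type*} [TopologicalSpace X] {F : Set (Set X)} {A : Set X}
    (hA : IsConnected A) (hF : ∀ B ∈ F, IsConnected B) : IsConnected (enlarge F A) := by
  obtain ⟨a, ha⟩ := hA.nonempty
  refine ⟨⟨a, .inl ha⟩, isPreconnected_of_forall a ?_⟩
  rintro y (hy | ⟨B, ⟨hB, hBA⟩, hy⟩)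
  · exact ⟨A, subset_union_left, ha, hy, hA.isPreconnected⟩
  · refine ⟨A ∪ B, union_subset_union_right A (subset_sUnion_of_mem ⟨hB, hBA⟩), .inl ha, .inr hy, ?_⟩
    exact (hA.union (by rwa [inter_comm]) (hF B hB)).isPreconnected

lemma iterEnlarge_mono {X : Type*} (F : ℕ → Set (Set X)) (A : Set X) :
    Monotone (iterEnlarge F A) :=
  monotone_nat_of_le_succ fun _ => subset_enlarge _ _

lemma subset_limEnlarge {X : Type*} (F : ℕ → Set (Set X)) (A : Set X) : A ⊆ limEnlarge F A :=
  subset_iUnion (iterEnlarge F A) 0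

lemma iterEnlarge_iUnion {X ι : Type*} (F : ℕ → Set (Set X)) (A : ι → Set X) (m : ℕ) :
    iterEnlarge F (⋃ i, A i) m = ⋃ i, iterEnlarge F (A i) m := by
  induction m with
  | zero => rfl
  | succ m ih => simp only [iterEnlarge, ih, enlarge_iUnion]

lemma limEnlarge_iUnion {X ι : Type*} (F : ℕ → Set (Set X)) (A : ι → Set X) :
    limEnlarge F (⋃ i, A i) = ⋃ i, limEnlarge F (A i) := by
  simp only [limEnlarge, iterEnlarge_iUnion]
  exact iUnion_comm _

lemma iterEnlarge_add {X : Type*} (F : ℕ → Set (Set X)) (A : Set X) (n m : ℕ) :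
    iterEnlarge F A (n + m) = iterEnlarge (fun k => F (n + k)) (iterEnlarge F A n) m := by
  induction m with
  | zero => rfl
  | succ m ih => rw [← add_assoc, iterEnlarge, iterEnlarge, ih]

lemma limEnlarge_eq_shift {X : Type*} (F : ℕ → Set (Set X)) (A : Set X) (n : ℕ) :
    limEnlarge F A = limEnlarge (fun k => F (n + k)) (iterEnlarge F A n) := by
  simp only [limEnlarge, ← iterEnlarge_add]
  refine Subset.antisymm (iUnion_subset fun m => ?_) (iUnion_subset fun m => subset_iUnion _ _)
  exact (iterEnlarge_mono F A (Nat.le_add_left m n)).trans (subset_iUnion_of_subset m subset_rfl)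

lemma IsConnected.limEnlarge {X : Type*} [TopologicalSpace X] {F : ℕ → Set (Set X)} {A : Set X}
    (hA : IsConnected A) (hF : ∀ n, ∀ B ∈ F n, IsConnected B) : IsConnected (limEnlarge F A) := by
  obtain ⟨a, ha⟩ := hA.nonempty
  refine ⟨⟨a, subset_limEnlarge F A ha⟩, isPreconnected_iUnion ⟨a, ?_⟩ fun m => ?_⟩
  · exact mem_iInter.2 fun m => iterEnlarge_mono F A (Nat.zero_le m) ha
  · suffices IsConnected (iterEnlarge F A m) from this.isPreconnected
    induction m with
    | zero => exact hA
    | succ m ih => exact ih.enlarge (hF m)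

lemma exists_dist_le_of_mem_limEnlarge {X : Type*} [PseudoMetricSpace X] {F : ℕ → Set (Set X)}
    {A : Set X} {c : ℝ} (hc : 0 ≤ c)
    (hF : ∀ n, ∀ B ∈ F n, ∀ y ∈ B, ∀ z ∈ B, dist y z ≤ c / 2 ^ n) {y : X}
    (hy : y ∈ limEnlarge F A) : ∃ a ∈ A, dist y a ≤ 2 * c := by
  have key (m : ℕ) : ∀ y ∈ iterEnlarge F A m, ∃ a ∈ A, dist y a ≤ 2 * c - 2 * c / 2 ^ m := by
    induction m with
    | zero => exact fun y hy => ⟨y, hy, by simp⟩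
    | succ m ih =>
      have hm : 2 * c - 2 * c / 2 ^ (m + 1) = c / 2 ^ m + (2 * c - 2 * c / 2 ^ m) := by
        field_simp; ring
      have hpos : 0 ≤ c / 2 ^ m := by positivity
      rw [hm]
      rintro y (hy | ⟨B, ⟨hB, z, hzB, hz⟩, hy⟩)
      · obtain ⟨a, ha, h⟩ := ih y hy
        exact ⟨a, ha, by linarith⟩
      · obtain ⟨a, ha, h⟩ := ih z hz
        exact ⟨a, ha, by linarith [dist_triangle y z a, hF m B hB y hy z hzB]⟩
  obtain ⟨m, hm⟩ := mem_iUnion.1 hy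
  obtain ⟨a, ha, h⟩ := key m y hm
  have : 0 ≤ 2 * c / 2 ^ m := by positivity
  exact ⟨a, ha, by linarith⟩

/-- A set that is, for every `ε`, a finite union of connected sets of diameter at most `ε` has a
locally connected closure. -/
lemma locallyConnectedSpace_closure {X : Type*} [PseudoMetricSpace X] {G : Set X}
    (hG : ∀ ε > 0, ∃ T : Set (Set X), T.Finite ∧ ⋃₀ T = G ∧
      ∀ B ∈ T, IsConnected B ∧ ∀ y ∈ B, ∀ z ∈ B, dist y z ≤ ε) :
    LocallyConnectedSpace ↥(closure G) := by
  refine locallyConnectedSpace_iff_connected_subsets.2 fun p U hU => ?_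
  obtain ⟨ε, hε, hεU⟩ := Metric.mem_nhds_iff.1 hU
  obtain ⟨T, hTfin, hTG, hT⟩ := hG (ε / 2) (half_pos hε)
  have hcl : closure G = ⋃ B ∈ T, closure B := by
    rw [← hTG, hTfin.closure_sUnion]
  have hsub {B : Set X} (hB : B ∈ T) : closure B ⊆ closure G :=
    hcl ▸ subset_biUnion_of_mem (u := fun B => closure B) hB
  let D (B : Set X) : Set ↥(closure G) := Subtype.val ⁻¹' closure B
  have hDclosed (B : Set X) : IsClosed (D B) := isClosed_closure.preimage continuous_subtype_val
  have hDconn {B : Set X} (hB : B ∈ T) : IsPreconnected (D B) := by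
    rw [← IsInducing.subtypeVal.isPreconnected_image, Subtype.image_preimage_coe,
      inter_eq_right.2 (hsub hB)]
    exact (hT B hB).1.isPreconnected.closure
  refine ⟨⋃₀ (D '' {B ∈ T | p ∈ D B}), ?_, ?_, ?_⟩
  · have hfar : IsClosed (⋃ B ∈ {B ∈ T | p ∉ D B}, D B) :=
      (hTfin.sep _).isClosed_biUnion fun B _ => hDclosed B
    filter_upwards [hfar.isOpen_compl.mem_nhds (by simp)] with q hq
    have hq' : (q : X) ∈ ⋃ B ∈ T, closure B := hcl ▸ q.2
    obtain ⟨B, hB, hqB⟩ := mem_iUnion₂.1 hq'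
    refine ⟨D B, ⟨B, ⟨hB, ?_⟩, rfl⟩, hqB⟩
    by_contra hp
    exact hq (mem_biUnion (show B ∈ {B ∈ T | p ∉ D B} from ⟨hB, hp⟩) hqB)
  · refine isPreconnected_sUnion p _ ?_ ?_
    · rintro _ ⟨B, hB, rfl⟩
      exact hB.2
    · rintro _ ⟨B, hB, rfl⟩
      exact hDconn hB.1
  · rintro q ⟨_, ⟨B, ⟨hB, hp⟩, rfl⟩, hq⟩
    apply hεU
    have : dist (q : X) p ∈ Iic (ε / 2) := by
      rw [← isClosed_Iic.closure_eq]
      exact map_mem_closure₂ continuous_dist hq hp (hT B hB).2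
    exact (show dist (q : X) p < ε from lt_of_le_of_lt this (half_lt_self hε))

lemma IsCompact.exists_finite_cover_isConnected {X : Type*} [PseudoMetricSpace X]
    [LocallyConnectedSpace X] {K : Set X} (hK : IsCompact K) {ε : ℝ} (hε : 0 < ε) :
    ∃ F : Set (Set X), F.Finite ∧ K ⊆ ⋃₀ F ∧
      ∀ B ∈ F, IsOpen B ∧ IsConnected B ∧ ∀ y ∈ B, ∀ z ∈ B, dist y z ≤ ε := by
  have (x : X) := locallyConnectedSpace_iff_subsets_isOpen_isConnected.1 ‹_› x
    (ball x (ε / 2)) (ball_mem_nhds x (half_pos hε))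
  choose V hVsub hVopen hxV hVconn using this
  obtain ⟨t, -, ht⟩ := hK.elim_nhds_subcover V fun x _ => (hVopen x).mem_nhds (hxV x)
  refine ⟨V '' t, t.finite_toSet.image V, by simpa [sUnion_image] using ht, ?_⟩
  rintro _ ⟨x, -, rfl⟩
  refine ⟨hVopen x, hVconn x, fun y hy z hz => ?_⟩
  have h₁ := mem_ball.1 (hVsub x hy)
  have h₂ := mem_ball.1 (hVsub x hz)
  linarith [dist_triangle_right y z x]

/-- Points of a locally compact, locally connected metric space have arbitrarily small compact,
connected, locally connected neighborhoods. -/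
lemma exists_mem_nhds_isCompact_isConnected_locallyConnectedSpace {X : Type*} [MetricSpace X]
    [LocallyCompactSpace X] [LocallyConnectedSpace X] (x : X) {U : Set X} (hU : U ∈ 𝓝 x) :
    ∃ V ∈ 𝓝 x, V ⊆ U ∧ IsCompact V ∧ IsConnected V ∧ LocallyConnectedSpace ↥V := by
  obtain ⟨r, ⟨hKc, hKU⟩, hr⟩ : ∃ r, (IsCompact (closedBall x r) ∧ closedBall x r ⊆ U) ∧ 0 < r :=
    ((eventually_nhdsWithin_of_eventually_nhds ((eventually_isCompact_closedBall x).and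
      (eventually_closedBall_subset hU))).and (self_mem_nhdsWithin (s := Ioi (0 : ℝ)))).exists
  set K := closedBall x r
  obtain ⟨c, hc, rfl⟩ : ∃ c, 0 < c ∧ r = 2 * c := ⟨r / 2, half_pos hr, by ring⟩
  have hcov (n : ℕ) := hKc.exists_finite_cover_isConnected (ε := c / 2 ^ n) (by positivity)
  choose F hFfin hFK hF using hcov
  set G := limEnlarge F {x}
  have hGK : G ⊆ K := fun y hy => by
    obtain ⟨a, rfl, h⟩ := exists_dist_le_of_mem_limEnlarge hc.le (fun n B hB => (hF n B hB).2.2) hy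
    exact h
  have hVK : closure G ⊆ K := closure_minimal hGK isClosed_closedBall
  have hGconn : IsConnected G := isConnected_singleton.limEnlarge fun n B hB => (hF n B hB).2.1
  refine ⟨closure G, ?_, hVK.trans hKU, hKc.of_isClosed_subset isClosed_closure hVK,
    hGconn.closure, locallyConnectedSpace_closure fun ε hε => ?_⟩
  · obtain ⟨B, hB, hxB⟩ := hFK 0 (mem_closedBall_self hr.le)
    filter_upwards [(hF 0 B hB).1.mem_nhds hxB] with y hy
    refine subset_closure (mem_iUnion.2 ⟨1, .inr ⟨B, ⟨hB, x, hxB, rfl⟩, hy⟩⟩)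
  · obtain ⟨n, hn⟩ : ∃ n : ℕ, 3 * c * (1 / 2) ^ n < ε := by
      obtain ⟨n, hn⟩ := exists_pow_lt_of_lt_one (show 0 < ε / (3 * c) by positivity)
        (show (1 / 2 : ℝ) < 1 by norm_num)
      exact ⟨n, by rwa [lt_div_iff₀' (by positivity)] at hn⟩
    have hCK : iterEnlarge F {x} n ⊆ ⋃₀ F n :=
      (subset_iUnion (iterEnlarge F {x}) n).trans (hGK.trans (hFK n))
    have hfin : Finite {B // B ∈ F n ∧ (B ∩ iterEnlarge F {x} n).Nonempty} :=
      ((hFfin n).subset fun B hB => hB.1).to_subtype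
    have hF' (k : ℕ) : ∀ B ∈ F (n + 1 + k), ∀ y ∈ B, ∀ z ∈ B,
        dist y z ≤ c / 2 ^ (n + 1) / 2 ^ k := by
      rw [div_div, ← pow_add]
      exact fun B hB => (hF (n + 1 + k) B hB).2.2
    refine ⟨range fun B : {B // B ∈ F n ∧ (B ∩ iterEnlarge F {x} n).Nonempty} =>
      limEnlarge (fun k => F (n + 1 + k)) B, finite_range _, ?_, ?_⟩
    · rw [sUnion_range, ← limEnlarge_iUnion, ← enlarge_eq_biUnion hCK]
      exact (limEnlarge_eq_shift F {x} (n + 1)).symm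
    · rintro _ ⟨⟨B, hB, -⟩, rfl⟩
      refine ⟨(hF n B hB).2.1.limEnlarge fun k B hB => (hF _ B hB).2.1, fun y hy z hz => ?_⟩
      obtain ⟨a, ha, hya⟩ := exists_dist_le_of_mem_limEnlarge (by positivity) hF' hy
      obtain ⟨b, hb, hzb⟩ := exists_dist_le_of_mem_limEnlarge (by positivity) hF' hz
      have hab := (hF n B hB).2.2 a ha b hb
      have h₁ : 3 * c * (1 / 2) ^ n = c / 2 ^ n + 4 * (c / 2 ^ (n + 1)) := by
        rw [one_div, inv_pow]; field_simp; ring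
      rw [dist_comm] at hzb
      linarith [dist_triangle4 y a b z]

/-- A connected, locally compact metric space is second countable. -/
lemma secondCountableTopology_of_connectedSpace_locallyCompactSpace (X : Type*) [MetricSpace X]
    [ConnectedSpace X] [LocallyCompactSpace X] : SecondCountableTopology X := by
  choose K hKc hK using fun x : X => exists_compact_mem_nhds x
  obtain ⟨v, hvo, hvcov, hvlf, hvK⟩ := precise_refinement (fun x => interior (K x))
    (fun _ => isOpen_interior) (iUnion_eq_univ_iff.2 fun x => ⟨x, mem_interior_iff_mem_nhds.2 (hK x)⟩)
  have hvc (x : X) : IsCompact (closure (v x)) :=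
    (hKc x).closure_of_subset ((hvK x).trans interior_subset)
  have hmeet (x : X) : {y | (v y ∩ closure (v x)).Nonempty}.Finite :=
    hvlf.finite_nonempty_inter_compact (hvc x)
  obtain ⟨x₀⟩ := (inferInstance : Nonempty X)
  obtain ⟨i₀, hi₀⟩ := iUnion_eq_univ_iff.1 hvcov x₀
  let J : ℕ → Set X := fun n => Nat.rec {i₀} (fun _ S => ⋃ x ∈ S, {y | (v y ∩ closure (v x)).Nonempty}) n
  have hJ (n : ℕ) : (J n).Countable := by
    induction n with
    | zero => exact countable_singleton i₀
    | succ n ih => exact ih.biUnion fun x _ => (hmeet x).countable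
  set I := ⋃ n, J n
  have hI : I.Countable := countable_iUnion hJ
  have hIstep {x y : X} (hx : x ∈ I) (hy : (v y ∩ closure (v x)).Nonempty) : y ∈ I := by
    obtain ⟨n, hn⟩ := mem_iUnion.1 hx
    exact mem_iUnion.2 ⟨n + 1, mem_biUnion hn hy⟩
  set A := ⋃ x : I, v x
  have hAcl : closure A = ⋃ x : I, closure (v x) :=
    (hvlf.comp_injective Subtype.val_injective).closure_iUnion
  have hsub : closure A ⊆ A := by
    rw [hAcl]
    refine iUnion_subset fun ⟨x, hx⟩ y hy => ?_
    obtain ⟨z, hz⟩ := iUnion_eq_univ_iff.1 hvcov y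
    exact mem_iUnion.2 ⟨⟨z, hIstep hx ⟨y, hz, hy⟩⟩, hz⟩
  have hclopen : IsClopen A :=
    ⟨closure_subset_iff_isClosed.1 hsub, isOpen_iUnion fun x => hvo x⟩
  have hA : A = univ := hclopen.eq_univ ⟨x₀, mem_iUnion.2 ⟨⟨i₀, mem_iUnion.2 ⟨0, rfl⟩⟩, hi₀⟩⟩
  have hcover : ⋃₀ ((fun x => closure (v x)) '' I) = univ := by
    rw [eq_univ_iff_forall]
    intro y
    obtain ⟨⟨x, hx⟩, hxy⟩ := mem_iUnion.1 (hA.symm ▸ mem_univ y : y ∈ A)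
    exact ⟨_, ⟨x, hx, rfl⟩, subset_closure hxy⟩
  have : SigmaCompactSpace X :=
    .of_countable _ (hI.image _) (forall_mem_image.2 fun x _ => hvc x) hcover
  infer_instance

/-- Local compactness passes along a continuous map that is locally onto near some preimage of
each point. -/
lemma locallyCompactSpace_of_nhds_le_map {X Y : Type*} [TopologicalSpace X] [TopologicalSpace Y]
    [LocallyCompactSpace X] {f : X → Y} (hf : Continuous f)
    (h : ∀ y, ∃ x, f x = y ∧ 𝓝 y ≤ map f (𝓝 x)) : LocallyCompactSpace Y := by
  refine ⟨fun y U hU => ?_⟩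
  obtain ⟨x, rfl, hx⟩ := h y
  obtain ⟨K, hK, hKU, hKc⟩ := local_compact_nhds (hf.continuousAt hU)
  exact ⟨f '' K, hx (image_mem_map hK), image_subset_iff.2 hKU, hKc.image hf⟩

/-- Local connectedness passes along a continuous map that is locally onto near some preimage of
each point. -/
lemma locallyConnectedSpace_of_nhds_le_map {X Y : Type*} [TopologicalSpace X] [TopologicalSpace Y]
    [LocallyConnectedSpace X] {f : X → Y} (hf : Continuous f)
    (h : ∀ y, ∃ x, f x = y ∧ 𝓝 y ≤ map f (𝓝 x)) : LocallyConnectedSpace Y := by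
  refine locallyConnectedSpace_iff_connected_subsets.2 fun y U hU => ?_
  obtain ⟨x, rfl, hx⟩ := h y
  obtain ⟨V, hV, hVc, hVU⟩ :=
    locallyConnectedSpace_iff_connected_subsets.1 ‹_› x _ (hf.continuousAt hU)
  exact ⟨f '' V, hx (image_mem_map hV), hVc.image f hf.continuousOn, image_subset_iff.2 hVU⟩

lemma mem_omegaLimitSet_iff {φ : ℝ → M → M} {x z : M} :
    z ∈ omegaLimitSet φ x ↔ MapClusterPt z atTop fun t => φ t x := by
  simp only [omegaLimitSet, mem_iInter, mem_closure_iff_nhds, mapClusterPt_iff_frequently,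
    frequently_atTop]
  constructor
  · intro h s hs T
    obtain ⟨_, hy, t, ht, rfl⟩ := h (max T 0) (le_max_right T 0) s hs
    exact ⟨t, (le_max_left T 0).trans ht, hy⟩
  · intro h T _ s hs
    obtain ⟨t, ht, hy⟩ := h s hs T
    exact ⟨φ t x, hy, t, ht, rfl⟩

lemma isClosed_omegaLimitSet (φ : ℝ → M → M) (x : M) : IsClosed (omegaLimitSet φ x) :=
  isClosed_biInter fun _ _ => isClosed_closure

lemma omegaLimitSet_subset {φ : ℝ → M → M} {x : M} {K : Set M} (hK : IsClosed K)
    (h : ∀ᶠ t in atTop, φ t x ∈ K) : omegaLimitSet φ x ⊆ K :=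
  fun _ hz => hK.mem_of_mapClusterPt (mem_omegaLimitSet_iff.1 hz) h

lemma omegaLimitSet_nonempty {φ : ℝ → M → M} {x : M} {K : Set M} (hK : IsCompact K)
    (h : ∀ᶠ t in atTop, φ t x ∈ K) : (omegaLimitSet φ x).Nonempty := by
  obtain ⟨z, -, hz⟩ := hK.exists_mapClusterPt_of_frequently h.frequently
  exact ⟨z, mem_omegaLimitSet_iff.2 hz⟩

lemma continuous_flow_map {φ : ℝ → M → M} (hφcont : Continuous fun p : ℝ × M => φ p.1 p.2)
    (t : ℝ) : Continuous (φ t) :=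
  hφcont.comp (Continuous.prodMk_right t)

lemma isFlowInvariant_omegaLimitSet {φ : ℝ → M → M}
    (hφcont : Continuous fun p : ℝ × M => φ p.1 p.2)
    (hφadd : ∀ s t : ℝ, ∀ x : M, φ s (φ t x) = φ (s + t) x) (x : M) :
    IsFlowInvariant φ (omegaLimitSet φ x) := by
  intro z hz s
  rw [mem_omegaLimitSet_iff] at hz ⊢
  have h := hz.continuousAt_comp (continuous_flow_map hφcont s).continuousAt
  refine MapClusterPt.of_comp (tendsto_atTop_add_const_left atTop s tendsto_id) ?_
  simpa only [Function.comp_def, hφadd, id] using h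

lemma eventually_mem_of_mem_omegaLimitSet {φ : ℝ → M → M}
    (hφadd : ∀ s t : ℝ, ∀ x : M, φ s (φ t x) = φ (s + t) x) {x z : M} {V : Set M}
    (hz : z ∈ omegaLimitSet φ x) (hV : V ∈ 𝓝 z) (hVinv : IsPosInvariant φ V) :
    ∀ᶠ t in atTop, φ t x ∈ V := by
  obtain ⟨t, ht⟩ := ((mem_omegaLimitSet_iff.1 hz).frequently hV).exists
  filter_upwards [eventually_ge_atTop t] with s hs
  simpa [hφadd] using hVinv _ ht (s - t) (sub_nonneg.2 hs)

lemma exists_isCompactMinimalSet_subset {φ : ℝ → M → M} {K : Set M} (hKne : K.Nonempty)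
    (hK : IsCompact K) (hKinv : IsFlowInvariant φ K) : ∃ Γ ⊆ K, IsCompactMinimalSet φ Γ := by
  obtain ⟨Γ, hΓK, ⟨hΓne, hΓc, hΓinv⟩, hΓmin⟩ := zorn_superset_nonempty
    {L : Set M | L.Nonempty ∧ IsCompact L ∧ IsFlowInvariant φ L} (fun c hc hchain hcne => by
      refine ⟨⋂₀ c, ⟨?_, ?_, ?_⟩, fun s hs => sInter_subset_of_mem hs⟩
      · have := hcne.to_subtype
        have hdir : DirectedOn (· ⊇ ·) c := fun a ha b hb =>
          (hchain.total ha hb).elim (fun h => ⟨a, ha, subset_rfl, h⟩) fun h => ⟨b, hb, h, subset_rfl⟩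
        exact IsCompact.nonempty_sInter_of_directed_nonempty_isCompact_isClosed
          hdir (fun U hU => (hc hU).1) (fun U hU => (hc hU).2.1)
          fun U hU => (hc hU).2.1.isClosed
      · obtain ⟨L, hL⟩ := hcne
        exact (hc hL).2.1.of_isClosed_subset
          (isClosed_sInter fun U hU => (hc hU).2.1.isClosed) (sInter_subset_of_mem hL)
      · exact fun x hx t L hL => (hc hL).2.2 x (hx L hL) t) K ⟨hKne, hK, hKinv⟩
  exact ⟨Γ, hΓK, hΓne, hΓc, hΓinv, fun L hL hLne hLcl hLinv =>
    hL.antisymm (hΓmin ⟨hLne, hΓc.of_isClosed_subset hLcl hL, hLinv⟩ hL)⟩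

lemma IsCompactMinimalSet.omegaLimitSet_eq {φ : ℝ → M → M}
    (hφcont : Continuous fun p : ℝ × M => φ p.1 p.2)
    (hφadd : ∀ s t : ℝ, ∀ x : M, φ s (φ t x) = φ (s + t) x) {Λ : Set M}
    (hΛ : IsCompactMinimalSet φ Λ) {x : M} (hx : x ∈ Λ) : omegaLimitSet φ x = Λ := by
  have hev : ∀ᶠ t in atTop, φ t x ∈ Λ := .of_forall (hΛ.2.2.1 x hx)
  exact hΛ.2.2.2 _ (omegaLimitSet_subset hΛ.2.1.isClosed hev) (omegaLimitSet_nonempty hΛ.2.1 hev)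
    (isClosed_omegaLimitSet φ x) (isFlowInvariant_omegaLimitSet hφcont hφadd x)

lemma IsLyapunovStable.omegaLimitSet_subset {φ : ℝ → M → M}
    (hφadd : ∀ s t : ℝ, ∀ x : M, φ s (φ t x) = φ (s + t) x) {Γ : Set M} (hΓ : IsClosed Γ)
    (hstable : IsLyapunovStable φ Γ) {x z : M} (hz : z ∈ omegaLimitSet φ x) (hzΓ : z ∈ Γ) :
    omegaLimitSet φ x ⊆ Γ := by
  intro y hy
  by_contra hyΓ
  obtain ⟨r, hr, hrΓ⟩ := nhds_basis_closedBall.mem_iff.1 (hΓ.isOpen_compl.mem_nhds hyΓ)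
  obtain ⟨V, hV, hVr, hVinv⟩ := hstable (closedBall y r)ᶜ
    (isClosed_closedBall.isOpen_compl.mem_nhdsSet.2 (subset_compl_comm.1 hrΓ))
  have hev := eventually_mem_of_mem_omegaLimitSet hφadd hz (mem_nhdsSet_iff_forall.1 hV z hzΓ) hVinv
  obtain ⟨t, ht, htV⟩ := (((mem_omegaLimitSet_iff.1 hy).frequently
    (closedBall_mem_nhds y hr)).and_eventually hev).exists
  exact hVr htV ht

/-- Invariant compact sets contained in a small neighborhood of a minimal set are close to it. -/
lemma IsCompactMinimalSet.exists_isOpen_forall_subset_mem {φ : ℝ → M → M}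
    (hφcont : Continuous fun p : ℝ × M => φ p.1 p.2)
    (hφadd : ∀ s t : ℝ, ∀ x : M, φ s (φ t x) = φ (s + t) x) {Γ : NonemptyCompacts M}
    (hΓ : IsCompactMinimalSet φ (Γ : Set M)) {U : Set (NonemptyCompacts M)} (hU : U ∈ 𝓝 Γ) :
    ∃ O : Set M, IsOpen O ∧ (Γ : Set M) ⊆ O ∧
      ∀ Γ' : NonemptyCompacts M, IsFlowInvariant φ (Γ' : Set M) → (Γ' : Set M) ⊆ O → Γ' ∈ U := by
  obtain ⟨_, ⟨u, ⟨hufin, -, huo⟩, rfl⟩, ⟨hΓu, hΓmeet⟩, hsub⟩ :=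
    NonemptyCompacts.isTopologicalBasis.mem_nhds_iff.1 hU
  refine ⟨⋃₀ u ∩ ⋂ W ∈ u, ⋃ t : ℝ, φ t ⁻¹' W, ?_, ?_, ?_⟩
  · exact (isOpen_sUnion huo).inter (hufin.isOpen_biInter fun W hW =>
      isOpen_iUnion fun t => (huo W hW).preimage (continuous_flow_map hφcont t))
  · refine subset_inter hΓu (subset_iInter₂ fun W hW x hx => ?_)
    obtain ⟨z, hzΓ, hzW⟩ := hΓmeet W hW
    rw [← hΓ.omegaLimitSet_eq hφcont hφadd hx] at hzΓ
    obtain ⟨t, ht⟩ :=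
      ((mem_omegaLimitSet_iff.1 hzΓ).frequently ((huo W hW).mem_nhds hzW)).exists
    exact mem_iUnion.2 ⟨t, ht⟩
  · intro Γ' hinv hΓ'
    refine hsub ⟨fun x hx => (hΓ' hx).1, fun W hW => ?_⟩
    obtain ⟨x, hx⟩ := Γ'.nonempty
    obtain ⟨t, ht⟩ := mem_iUnion.1 (mem_iInter₂.1 (hΓ' hx).2 W hW)
    exact ⟨φ t x, hinv x hx t, ht⟩

/-- Points near one whose ω-limit set is hyper-stable have nearby hyper-stable ω-limit sets. -/
lemma IsHyperStable.eventually_omegaLimitSet [LocallyCompactSpace M] {φ : ℝ → M → M}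
    (hφcont : Continuous fun p : ℝ × M => φ p.1 p.2)
    (hφadd : ∀ s t : ℝ, ∀ x : M, φ s (φ t x) = φ (s + t) x) {y : M}
    (hy : IsHyperStable φ (omegaLimitSet φ y)) {O : Set M} (hO : IsOpen O)
    (hyO : omegaLimitSet φ y ⊆ O) :
    ∀ᶠ x in 𝓝 y, IsHyperStable φ (omegaLimitSet φ x) ∧ omegaLimitSet φ x ⊆ O := by
  obtain ⟨hmin, W, hW, hWstable⟩ := hy
  have hstable : IsLyapunovStable φ (omegaLimitSet φ y) := by
    by_contra h
    obtain ⟨z, hz⟩ := hmin.1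
    exact (hWstable _ hmin h).subset ⟨hz, subset_of_mem_nhdsSet hW hz⟩
  obtain ⟨K, hKc, hyK, hKsub⟩ := exists_compact_between hmin.2.1 (hO.inter isOpen_interior)
    (subset_inter hyO (subset_interior_iff_mem_nhdsSet.2 hW))
  obtain ⟨V, hV, hVK, hVinv⟩ := hstable K (subset_interior_iff_mem_nhdsSet.1 hyK)
  obtain ⟨z, hz⟩ := hmin.1
  obtain ⟨t, ht⟩ := ((mem_omegaLimitSet_iff.1 hz).frequently
    (interior_mem_nhds.2 (mem_nhdsSet_iff_forall.1 hV z hz))).exists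
  filter_upwards [(continuous_flow_map hφcont t).continuousAt (isOpen_interior.mem_nhds ht)]
    with x hx
  have hev : ∀ᶠ s in atTop, φ s x ∈ K := by
    filter_upwards [eventually_ge_atTop t] with s hs
    exact hVK (by simpa [hφadd] using hVinv _ (interior_subset hx) (s - t) (sub_nonneg.2 hs))
  have hωK : omegaLimitSet φ x ⊆ K := _root_.omegaLimitSet_subset hKc.isClosed hev
  obtain ⟨Γ, hΓsub, hΓ⟩ := exists_isCompactMinimalSet_subset (omegaLimitSet_nonempty hKc hev)
    (hKc.of_isClosed_subset (isClosed_omegaLimitSet φ x) hωK)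
    (isFlowInvariant_omegaLimitSet hφcont hφadd x)
  obtain ⟨w, hw⟩ := hΓ.1
  have hωW : omegaLimitSet φ x ⊆ interior W := fun p hp => (hKsub (hωK hp)).2
  have hΓstable : IsLyapunovStable φ Γ := by
    by_contra h
    exact (hWstable _ hΓ h).subset ⟨hw, interior_subset (hωW (hΓsub hw))⟩
  have heq : omegaLimitSet φ x = Γ :=
    (hΓstable.omegaLimitSet_subset hφadd hΓ.2.1.isClosed (hΓsub hw) hw).antisymm hΓsub
  exact ⟨⟨heq ▸ hΓ, W, subset_interior_iff_mem_nhdsSet.1 hωW, hWstable⟩,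
    fun p hp => (hKsub (hωK hp)).1⟩

/-- The map sending a point with hyper-stable ω-limit set to that ω-limit set. -/
def omegaLimitMap (φ : ℝ → M → M) (y : {y : M // IsHyperStable φ (omegaLimitSet φ y)}) :
    ↥(HSset φ) :=
  ⟨⟨⟨omegaLimitSet φ y, y.2.1.2.1⟩, y.2.1.1⟩, y.2⟩

lemma continuous_omegaLimitMap [LocallyCompactSpace M] {φ : ℝ → M → M}
    (hφcont : Continuous fun p : ℝ × M => φ p.1 p.2)
    (hφadd : ∀ s t : ℝ, ∀ x : M, φ s (φ t x) = φ (s + t) x) : Continuous (omegaLimitMap φ) := by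
  refine continuous_induced_rng.2 (continuous_iff_continuousAt.2 fun y U hU => ?_)
  obtain ⟨O, hO, hyO, hOU⟩ := IsCompactMinimalSet.exists_isOpen_forall_subset_mem
    (Γ := (omegaLimitMap φ y : NonemptyCompacts M)) hφcont hφadd y.2.1 hU
  have hev := y.2.eventually_omegaLimitSet hφcont hφadd hO hyO
  exact mem_map.2 (mem_of_superset (continuous_subtype_val.continuousAt hev)
    fun x hx => hOU _ x.2.1.2.2.1 hx.2)

lemma exists_omegaLimitMap_eq_nhds_le_map {φ : ℝ → M → M}
    (hφcont : Continuous fun p : ℝ × M => φ p.1 p.2)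
    (hφadd : ∀ s t : ℝ, ∀ x : M, φ s (φ t x) = φ (s + t) x) (Λ : ↥(HSset φ)) :
    ∃ x, omegaLimitMap φ x = Λ ∧ 𝓝 Λ ≤ map (omegaLimitMap φ) (𝓝 x) := by
  have hmem (Γ : ↥(HSset φ)) {x : M} (hx : x ∈ (Γ : NonemptyCompacts M)) :
      omegaLimitSet φ x = (Γ : NonemptyCompacts M) := Γ.2.1.omegaLimitSet_eq hφcont hφadd hx
  have hlift (Γ : ↥(HSset φ)) {x : M} (hx : x ∈ (Γ : NonemptyCompacts M)) :
      ∃ h : IsHyperStable φ (omegaLimitSet φ x), omegaLimitMap φ ⟨x, h⟩ = Γ :=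
    ⟨(hmem Γ hx).symm ▸ Γ.2, Subtype.ext (SetLike.coe_injective (hmem Γ hx))⟩
  obtain ⟨x, hx⟩ := (Λ : NonemptyCompacts M).nonempty
  obtain ⟨hxs, hxΛ⟩ := hlift Λ hx
  refine ⟨⟨x, hxs⟩, hxΛ, fun U hU => ?_⟩
  obtain ⟨N, hN, hNU⟩ := mem_nhds_subtype _ _ _ |>.1 (mem_map.1 hU)
  have hopen := (NonemptyCompacts.isOpen_inter_nonempty_of_isOpen
    (isOpen_interior (s := N))).preimage (continuous_subtype_val (p := (· ∈ HSset φ)))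
  filter_upwards [hopen.mem_nhds ⟨x, hx, mem_interior_iff_mem_nhds.2 hN⟩] with Γ hΓ
  obtain ⟨y, hyΓ, hyN⟩ := hΓ
  obtain ⟨hys, hy⟩ := hlift Γ hyΓ
  have hyU : omegaLimitMap φ ⟨y, hys⟩ ∈ U := hNU (mem_preimage.2 (interior_subset hyN : y ∈ N))
  exact hy ▸ hyU

lemma isOpen_setOf_isHyperStable_omegaLimitSet [LocallyCompactSpace M] {φ : ℝ → M → M}
    (hφcont : Continuous fun p : ℝ × M => φ p.1 p.2)
    (hφadd : ∀ s t : ℝ, ∀ x : M, φ s (φ t x) = φ (s + t) x) :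
    IsOpen {y | IsHyperStable φ (omegaLimitSet φ y)} :=
  isOpen_iff_mem_nhds.2 fun _ hy => (IsHyperStable.eventually_omegaLimitSet hφcont hφadd hy
    isOpen_univ (subset_univ _)).mono fun _ h => h.1

theorem HS_locally_peano_and_countable_clopen_components [LocallyCompactSpace M] [ConnectedSpace M] [LocallyConnectedSpace M]
    (φ : ℝ → M → M)
    (hφcont : Continuous fun p : ℝ × M => φ p.1 p.2)
    (hφzero : ∀ x : M, φ 0 x = x)
    (hφadd : ∀ s t : ℝ, ∀ x : M, φ s (φ t x) = φ (s + t) x)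
    :
    (∀ p : ↥(HSset φ), ∀ U ∈ 𝓝 p, ∃ V ∈ 𝓝 p, V ⊆ U ∧ IsCompact V ∧ IsConnected V ∧
        LocallyConnectedSpace ↥V) ∧
      {S : Set ↥(HSset φ) | ∃ p : ↥(HSset φ), S = connectedComponent p}.Countable ∧
      ∀ p : ↥(HSset φ), IsClopen (connectedComponent p) ∧
        LocallyCompactSpace ↥(connectedComponent p) ∧
        ConnectedSpace ↥(connectedComponent p) ∧
        LocallyConnectedSpace ↥(connectedComponent p) := by
  have hBopen := isOpen_setOf_isHyperStable_omegaLimitSet hφcont hφadd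
  have : LocallyCompactSpace {y : M // IsHyperStable φ (omegaLimitSet φ y)} :=
    hBopen.locallyCompactSpace
  have : LocallyConnectedSpace {y : M // IsHyperStable φ (omegaLimitSet φ y)} :=
    hBopen.locallyConnectedSpace
  have hcont := continuous_omegaLimitMap hφcont hφadd
  have honto := exists_omegaLimitMap_eq_nhds_le_map hφcont hφadd
  have : LocallyCompactSpace ↥(HSset φ) := locallyCompactSpace_of_nhds_le_map hcont honto
  have : LocallyConnectedSpace ↥(HSset φ) := locallyConnectedSpace_of_nhds_le_map hcont honto
  have : SecondCountableTopology M :=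
    secondCountableTopology_of_connectedSpace_locallyCompactSpace M
  refine ⟨fun p U hU => exists_mem_nhds_isCompact_isConnected_locallyConnectedSpace p hU, ?_,
    fun p => ⟨isClopen_connectedComponent, isOpen_connectedComponent.locallyCompactSpace,
      isConnected_iff_connectedSpace.1 isConnected_connectedComponent,
      isOpen_connectedComponent.locallyConnectedSpace⟩⟩
  refine Set.PairwiseDisjoint.countable_of_isOpen (s := id) ?_ ?_ ?_
  · rintro _ ⟨p, rfl⟩ _ ⟨q, rfl⟩ hpq
    exact connectedComponent_disjoint hpq
  · rintro _ ⟨p, rfl⟩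
    exact isOpen_connectedComponent
  · rintro _ ⟨p, rfl⟩
    exact ⟨p, mem_connectedComponent⟩
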